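/- Let 0 < p₁ ≤ 1 and p₁ < p₂ ≤ 2. Then there exist constants C₁, C₂ > 0 depending only on p₁ and p₂ such that for all N, n ∈ ℕ with 2 ≤ n ≤ N, the n-th Gelfand number of the identity map from ℓ_{p₁}^N to ℓ_{p₂}^N satisfies C₁ · min{ 1, (ln(N/(n−1)) + 1)/(n−1) }^{1/p₁ − 1/p₂} ≤ c_n(id : ℓ_{p₁}^N → ℓ_{p₂}^N) ≤ C₂ · min{ 1, (ln(N/(n−1)) + 1)/(n−1) }^{1/p₁ − 1/p₂}. -/

import Mathlib

open scoped ENNReal BigOperators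

/-- The ℓ_p quasi-norm on ℝ^N, for `p : ℝ≥0∞` (with `p = ∞` giving the sup-norm). -/
noncomputable def pNorm (p : ℝ≥0∞) {N : ℕ} (x : Fin N → ℝ) : ℝ :=
  if p = ∞ then ⨆ i, |x i| else (∑ i, |x i| ^ p.toReal) ^ (1 / p.toReal)

/-- The n-th Kolmogorov number of the identity map `id : ℓ_p^N → ℓ_q^N`. -/
noncomputable def kolmogorovNumber (p q : ℝ≥0∞) (N n : ℕ) : ℝ :=
  sInf { r : ℝ | ∃ V : Submodule ℝ (Fin N → ℝ), Module.finrank ℝ (↥V) < n ∧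
    r = sSup { s : ℝ | ∃ x : Fin N → ℝ, pNorm p x ≤ 1 ∧
      s = sInf { t : ℝ | ∃ v ∈ V, t = pNorm q (x - v) } } }

/-- The n-th Gelfand number of the identity map `id : ℓ_p^N → ℓ_q^N`. -/
noncomputable def gelfandNumber (p q : ℝ≥0∞) (N n : ℕ) : ℝ :=
  sInf { r : ℝ | ∃ M : Submodule ℝ (Fin N → ℝ), N - Module.finrank ℝ (↥M) < n ∧
    r = sSup { s : ℝ | ∃ x ∈ M, pNorm p x ≤ 1 ∧ s = pNorm q x } }

/-- The n-th approximation number of the identity map `id : ℓ_p^N → ℓ_q^N`. -/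
noncomputable def approxNumber (p q : ℝ≥0∞) (N n : ℕ) : ℝ :=
  sInf { r : ℝ | ∃ L : (Fin N → ℝ) →ₗ[ℝ] (Fin N → ℝ),
    Module.finrank ℝ (↥(LinearMap.range L)) < n ∧
    r = sSup { s : ℝ | ∃ x : Fin N → ℝ, pNorm p x ≤ 1 ∧ s = pNorm q (x - L x) } }

open Finset

lemma exists_multiset_sum_approx {ι E : Type*} [Fintype ι] [NormedAddCommGroup E]
    [InnerProductSpace ℝ E] {w : ι → ℝ} (hw : ∀ i, 0 ≤ w i) (hw1 : ∑ i, w i = 1)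
    {h : ι → E} {R : ℝ} (hR : ∀ i, ‖h i‖ ^ 2 ≤ R) (k : ℕ) :
    ∃ s : Multiset ι, Multiset.card s = k ∧
      ‖(s.map h).sum - (k : ℝ) • ∑ i, w i • h i‖ ^ 2 ≤ k * R := by
  set y := ∑ i, w i • h i with hy
  induction k with
  | zero => exact ⟨0, by simp⟩
  | succ k ih =>
    obtain ⟨s, hs, hb⟩ := ih
    set v := (s.map h).sum - (k : ℝ) • y with hv
    have hinner : ∀ u : E, ∑ i, w i * inner ℝ u (h i) = inner ℝ u y := by
      intro u
      simp [hy, inner_sum, inner_smul_right]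
    have key : ∑ i, w i * ‖v + (h i - y)‖ ^ 2 ≤ ∑ i, w i * ((k + 1 : ℕ) * R) := by
      have e : ∀ i, w i * ‖v + (h i - y)‖ ^ 2 =
          w i * ‖v‖ ^ 2 + 2 * (w i * inner ℝ v (h i)) - 2 * w i * inner ℝ v y
            + w i * ‖h i‖ ^ 2 - 2 * (w i * inner ℝ y (h i)) + w i * ‖y‖ ^ 2 := by
        intro i
        rw [norm_add_sq_real, norm_sub_sq_real (h i) y, inner_sub_right, real_inner_comm y (h i)]
        ring
      have e2 : ∑ i, w i * ‖h i‖ ^ 2 ≤ R := by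
        calc _ ≤ ∑ i, w i * R := by gcongr with i; exacts [hw i, hR i]
          _ = R := by rw [← Finset.sum_mul, hw1, one_mul]
      simp only [e, Finset.sum_add_distrib, Finset.sum_sub_distrib, ← Finset.sum_mul,
        ← Finset.mul_sum, hinner, hw1, real_inner_self_eq_norm_sq]
      push_cast
      nlinarith [sq_nonneg ‖y‖]
    obtain ⟨i, hi⟩ : ∃ i, ‖v + (h i - y)‖ ^ 2 ≤ (k + 1 : ℕ) * R := by
      by_contra! hcon
      obtain ⟨j, -, hj⟩ : ∃ j ∈ Finset.univ, 0 < w j := by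
        by_contra! h0
        have := Finset.sum_nonpos h0
        linarith
      exact absurd key (not_le.mpr (Finset.sum_lt_sum
        (fun i _ => mul_le_mul_of_nonneg_left (hcon i).le (hw i))
        ⟨j, mem_univ _, mul_lt_mul_of_pos_left (hcon j) hj⟩))
    refine ⟨i ::ₘ s, by simp [hs], ?_⟩
    convert hi using 3
    simp only [Multiset.map_cons, Multiset.sum_cons, hv]
    push_cast
    module

/-- The sign `1` or `-1` attached to a Boolean. -/
def boolSign (b : Bool) : ℝ := if b then 1 else -1

lemma sum_sign_cons {N : ℕ} (z : Fin (N + 1) → ℝ) (F : ℝ → ℝ) :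
    ∑ ε : Fin (N + 1) → Bool, F (∑ i, boolSign (ε i) * z i) =
      ∑ ε : Fin N → Bool, (F (z 0 + ∑ i, boolSign (ε i) * z i.succ) +
        F (-z 0 + ∑ i, boolSign (ε i) * z i.succ)) := by
  rw [← (Fin.consEquiv (fun _ => Bool)).sum_comp, Fintype.sum_prod_type_right]
  simp [Fin.consEquiv, Fin.sum_univ_succ, boolSign]

lemma sum_sign_sq {N : ℕ} (z : Fin N → ℝ) :
    ∑ ε : Fin N → Bool, (∑ i, boolSign (ε i) * z i) ^ 2 = 2 ^ N * ∑ i, z i ^ 2 := by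
  induction N with
  | zero => simp
  | succ N ih =>
    rw [sum_sign_cons z (fun t => t ^ 2), Fin.sum_univ_succ (fun i => z i ^ 2)]
    have e : ∀ t : ℝ, (z 0 + t) ^ 2 + (-z 0 + t) ^ 2 = 2 * z 0 ^ 2 + 2 * t ^ 2 := fun t => by ring
    simp only [e, Finset.sum_add_distrib, ← Finset.mul_sum, ih]
    simp
    ring

lemma sum_sign_pow_four_le {N : ℕ} (z : Fin N → ℝ) :
    ∑ ε : Fin N → Bool, (∑ i, boolSign (ε i) * z i) ^ 4 ≤ 2 ^ N * (3 * (∑ i, z i ^ 2) ^ 2) := by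
  induction N with
  | zero => simp
  | succ N ih =>
    rw [sum_sign_cons z (fun t => t ^ 4), Fin.sum_univ_succ (fun i => z i ^ 2)]
    have e : ∀ t : ℝ, (z 0 + t) ^ 4 + (-z 0 + t) ^ 4 =
      2 * z 0 ^ 4 + 12 * z 0 ^ 2 * t ^ 2 + 2 * t ^ 4 := fun t => by ring
    simp only [e, Finset.sum_add_distrib, ← Finset.mul_sum, sum_sign_sq]
    have := ih (fun i => z i.succ)
    have h2 : (0 : ℝ) < 2 ^ N := by positivity
    simp
    rw [pow_succ (2 : ℝ) N]
    nlinarith [mul_nonneg h2.le (by positivity : 0 ≤ z 0 ^ 4)]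

lemma exp_neg_le_quadratic {t : ℝ} (ht : 0 ≤ t) : Real.exp (-t) ≤ 1 - t + t ^ 2 / 2 := by
  have h1 := Real.quadratic_le_exp_of_nonneg ht
  rw [Real.exp_neg]
  rw [inv_le_comm₀ (Real.exp_pos t) (by nlinarith [sq_nonneg (t - 1)])]
  refine le_trans ?_ h1
  rw [inv_le_iff_one_le_mul₀ (by nlinarith [sq_nonneg (t - 1)])]
  nlinarith [sq_nonneg (t ^ 2)]

lemma sum_exp_sign_le {N : ℕ} (z : Fin N → ℝ) (hz : ∑ i, z i ^ 2 = 1) :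
    ∑ ε : Fin N → Bool, Real.exp (-((∑ i, boolSign (ε i) * z i) ^ 2 / 3)) ≤ 2 ^ N * (5 / 6) := by
  have h4 := sum_sign_pow_four_le z
  have h2 := sum_sign_sq z
  rw [hz] at h2 h4
  calc _ ≤ ∑ ε : Fin N → Bool, (1 - (∑ i, boolSign (ε i) * z i) ^ 2 / 3
        + (∑ i, boolSign (ε i) * z i) ^ 4 / 18) := by
        refine Finset.sum_le_sum fun ε _ => (exp_neg_le_quadratic (by positivity)).trans_eq ?_
        ring
    _ ≤ _ := by
        rw [Finset.sum_add_distrib, Finset.sum_sub_distrib, ← Finset.sum_div, ← Finset.sum_div, h2]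
        simp
        linarith

lemma card_sign_matrix_le {N : ℕ} (m : ℕ) (z : Fin N → ℝ) :
    (#{A : Fin m → Fin N → Bool |
      ∑ i, (∑ j, boolSign (A i j) * z j) ^ 2 < m / 4 * ∑ j, z j ^ 2} : ℝ) ≤
      (2 ^ N) ^ m * (10 / 11) ^ m := by
  have hz0 : 0 ≤ ∑ j, z j ^ 2 := Finset.sum_nonneg fun j _ => sq_nonneg _
  rcases hz0.eq_or_lt with hz | hz
  · rw [← hz, mul_zero, Finset.filter_false_of_mem]
    · simp only [card_empty, Nat.cast_zero]
      positivity
    · intro A _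
      exact not_lt.mpr (Finset.sum_nonneg fun j _ => sq_nonneg _)
  set σ := ∑ j, z j ^ 2 with hσ
  have hunit := sum_exp_sign_le (fun j => z j / √σ) (by
    simp only [div_pow, Real.sq_sqrt hz0, ← Finset.sum_div]
    exact div_self hz.ne')
  have hscale : ∀ ε : Fin N → Bool, (∑ j, boolSign (ε j) * (z j / √σ)) ^ 2 =
      (∑ j, boolSign (ε j) * z j) ^ 2 / σ := by
    intro ε
    simp only [← mul_div_assoc, ← Finset.sum_div, div_pow, Real.sq_sqrt hz0]
  simp only [hscale] at hunit
  have hexp : Real.exp (1 / 12) * (5 / 6) ≤ 10 / 11 := by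
    have h := Real.one_sub_le_exp_neg (1 / 12)
    rw [Real.exp_neg] at h
    have h' := (le_inv_comm₀ (by norm_num) (Real.exp_pos _)).mp h
    norm_num at h' ⊢
    linarith
  calc (#{A : Fin m → Fin N → Bool |
      ∑ i, (∑ j, boolSign (A i j) * z j) ^ 2 < m / 4 * σ} : ℝ)
      = ∑ A : Fin m → Fin N → Bool,
          if ∑ i, (∑ j, boolSign (A i j) * z j) ^ 2 < m / 4 * σ then 1 else 0 := by simp
    _ ≤ ∑ A : Fin m → Fin N → Bool, ∏ i, (Real.exp (1 / 12) *
          Real.exp (-((∑ j, boolSign (A i j) * z j) ^ 2 / σ / 3))) := by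
        refine Finset.sum_le_sum fun A _ => ?_
        split_ifs with hA
        · simp only [← Real.exp_add, ← Real.exp_sum]
          rw [Real.one_le_exp_iff, Finset.sum_add_distrib, Finset.sum_neg_distrib,
            ← Finset.sum_div, ← Finset.sum_div]
          have : (∑ i, (∑ j, boolSign (A i j) * z j) ^ 2) / σ ≤ m / 4 :=
            (div_le_iff₀ hz).mpr hA.le
          simp only [← Finset.sum_div, Finset.sum_const, card_univ, Fintype.card_fin,
            nsmul_eq_mul]
          linarith
        · positivity
    _ = (Real.exp (1 / 12) * ∑ ε : Fin N → Bool,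
          Real.exp (-((∑ j, boolSign (ε j) * z j) ^ 2 / σ / 3))) ^ m := by
        rw [Finset.mul_sum, Fintype.sum_pow]
    _ ≤ (Real.exp (1 / 12) * (2 ^ N * (5 / 6))) ^ m := by gcongr
    _ ≤ (2 ^ N * (10 / 11)) ^ m := by
        refine pow_le_pow_left₀ (by positivity) ?_ m
        nlinarith [pow_pos (two_pos : (0 : ℝ) < 2) N]
    _ = _ := by rw [mul_pow]

/-- The signed unit vector attached to an index and a sign. -/
def signedBasis {N : ℕ} (a : Fin N × Bool) : Fin N → ℝ := boolSign a.2 • Pi.single a.1 1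

lemma exists_sign_matrix {N m k : ℕ}
    (hk : ((2 * N + k - 1).choose k : ℝ) * (10 / 11) ^ m < 1) :
    ∃ A : Fin m → Fin N → Bool, ∀ s : Multiset (Fin N × Bool), Multiset.card s = k →
      m / 4 * ∑ j, (s.map signedBasis).sum j ^ 2 ≤
        ∑ i, (∑ j, boolSign (A i j) * (s.map signedBasis).sum j) ^ 2 := by
  classical
  by_contra! hcon
  have hsub : (Finset.univ : Finset (Fin m → Fin N → Bool)) ⊆
      (Finset.univ : Finset (Sym (Fin N × Bool) k)).biUnion fun s =>
        {A : Fin m → Fin N → Bool | ∑ i, (∑ j, boolSign (A i j) *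
          ((s : Multiset (Fin N × Bool)).map signedBasis).sum j) ^ 2 <
            m / 4 * ∑ j, ((s : Multiset (Fin N × Bool)).map signedBasis).sum j ^ 2} := by
    intro A _
    obtain ⟨s, hs, h⟩ := hcon A
    simp only [mem_biUnion, mem_univ, true_and, mem_filter]
    exact ⟨⟨s, hs⟩, h⟩
  have h1 : ((2 : ℝ) ^ N) ^ m ≤ (2 * N + k - 1).choose k * ((2 ^ N) ^ m * (10 / 11) ^ m) := by
    calc ((2 : ℝ) ^ N) ^ m = (#(Finset.univ : Finset (Fin m → Fin N → Bool)) : ℝ) := by simp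
      _ ≤ ∑ s : Sym (Fin N × Bool) k, (#{A : Fin m → Fin N → Bool | ∑ i, (∑ j, boolSign (A i j) *
          ((s : Multiset (Fin N × Bool)).map signedBasis).sum j) ^ 2 <
            m / 4 * ∑ j, ((s : Multiset (Fin N × Bool)).map signedBasis).sum j ^ 2} : ℝ) := by
          exact_mod_cast (card_le_card hsub).trans card_biUnion_le
      _ ≤ ∑ s : Sym (Fin N × Bool) k, (((2 : ℝ) ^ N) ^ m * (10 / 11) ^ m) :=
          Finset.sum_le_sum fun s _ => card_sign_matrix_le m _
      _ = _ := by
          rw [Finset.sum_const, card_univ, Sym.card_sym_eq_choose, nsmul_eq_mul]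
          simp [mul_comm]
  have h2 : (0 : ℝ) < (2 ^ N) ^ m := by positivity
  nlinarith

lemma exists_submodule_sq_sum_le {N m k : ℕ} (hm : 0 < m) (hk0 : 0 < k)
    (hk : ((2 * N + k - 1).choose k : ℝ) * (10 / 11) ^ m < 1) :
    ∃ M : Submodule ℝ (Fin N → ℝ), N ≤ m + Module.finrank ℝ M ∧
      ∀ x ∈ M, ∑ i, |x i| = 1 → ∑ i, x i ^ 2 ≤ 16 / k := by
  obtain ⟨A, hA⟩ := exists_sign_matrix hk
  let T : (Fin N → ℝ) →ₗ[ℝ] (Fin m → ℝ) :=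
    Matrix.mulVecLin (Matrix.of fun i j => boolSign (A i j))
  have hT : ∀ x i, T x i = ∑ j, boolSign (A i j) * x j := fun x i => rfl
  have hm' : (0 : ℝ) < m := by exact_mod_cast hm
  let Φ : (Fin N → ℝ) →ₗ[ℝ] EuclideanSpace ℝ (Fin N ⊕ Fin m) :=
    { toFun := fun v => WithLp.toLp 2 (Sum.elim v ((√m)⁻¹ • T v))
      map_add' := fun u v => by
        ext i; cases i <;> simp
      map_smul' := fun c v => by
        ext i; cases i <;> simp [mul_left_comm] }
  have hΦ : ∀ v, ‖Φ v‖ ^ 2 = ∑ j, v j ^ 2 + (∑ i, (T v i) ^ 2) / m := by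
    intro v
    simp [Φ, EuclideanSpace.norm_sq_eq, mul_pow, inv_pow, Finset.mul_sum, div_eq_inv_mul]
  refine ⟨LinearMap.ker T, ?_, ?_⟩
  · have h1 := LinearMap.finrank_range_add_finrank_ker T
    have h2 := Submodule.finrank_le (LinearMap.range T)
    simp only [Module.finrank_fin_fun] at h1 h2
    omega
  intro x hx hx1
  have hTx : T x = 0 := hx
  have hbs : ∀ b, boolSign b ^ 2 = 1 := by intro b; cases b <;> simp [boolSign]
  let w : Fin N × Bool → ℝ := fun a => max (boolSign a.2 * x a.1) 0
  have hmax : ∀ t : ℝ, max t 0 + max (-t) 0 = |t| := fun t => by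
    rcases le_total 0 t with h | h
    · simp [h, abs_of_nonneg]
    · simp [h, abs_of_nonpos]
  have hmax2 : ∀ t : ℝ, max t 0 - max (-t) 0 = t := fun t => by
    rcases le_total 0 t with h | h
    · simp [h]
    · simp [h]
  have hw1 : ∑ a, w a = 1 := by
    simp [w, Fintype.sum_prod_type, boolSign, hmax, hx1]
  have hwx : ∑ a, w a • Φ (signedBasis a) = Φ x := by
    simp only [← map_smul, ← map_sum]
    congr 1
    ext j
    simp [w, Fintype.sum_prod_type, boolSign, signedBasis, Pi.single_apply,
      Finset.sum_apply, ← sub_eq_add_neg, hmax2]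
  obtain ⟨s, hs, hb⟩ := exists_multiset_sum_approx (fun a => le_max_right _ _) hw1
    (h := fun a => Φ (signedBasis a)) (R := 2) (fun a => by
      rw [hΦ]
      have e1 : ∑ j, signedBasis a j ^ 2 = 1 := by
        simp [signedBasis, Pi.single_apply, hbs]
      have e2 : ∀ i, T (signedBasis a) i ^ 2 = 1 := by
        intro i
        simp [hT, signedBasis, Pi.single_apply, mul_pow, hbs]
      simp only [e1, e2]
      simp [hm'.ne']
      norm_num) k
  set z := (s.map signedBasis).sum with hz
  have hzs : (s.map fun a => Φ (signedBasis a)).sum = Φ z := by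
    rw [hz, map_multiset_sum, Multiset.map_map]; rfl
  rw [hwx, hzs, ← map_smul, ← map_sub, hΦ] at hb
  simp only [map_sub, map_smul, hTx, smul_zero, sub_zero] at hb
  have hzA := hA s hs
  rw [← hz] at hzA
  simp only [← hT] at hzA
  have hzA' : (∑ j, z j ^ 2) / 4 ≤ (∑ i, (T z i) ^ 2) / m := by
    rw [le_div_iff₀ hm']; linarith
  have hk' : (0 : ℝ) < k := by exact_mod_cast hk0
  have hfin : (k : ℝ) ^ 2 * ∑ j, x j ^ 2 ≤
      2 * ∑ j, (z - (k : ℝ) • x) j ^ 2 + 2 * ∑ j, z j ^ 2 := by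
    rw [Finset.mul_sum, Finset.mul_sum, Finset.mul_sum, ← Finset.sum_add_distrib]
    refine Finset.sum_le_sum fun j _ => ?_
    simp only [Pi.sub_apply, Pi.smul_apply, smul_eq_mul]
    nlinarith [sq_nonneg (2 * z j - k * x j)]
  rw [le_div_iff₀ hk']
  have h0 : 0 ≤ ∑ j, (z - (k : ℝ) • x) j ^ 2 := Finset.sum_nonneg fun j _ => sq_nonneg _
  have : (k : ℝ) * (k * ∑ j, x j ^ 2) ≤ k * 16 := by nlinarith
  linarith [le_of_mul_le_mul_left this hk']

lemma choose_mul_pow_lt_one {N m k : ℕ} (hm : 0 < m) (hmN : m ≤ N) (hk0 : 0 < k)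
    (hk : (k : ℝ) * (Real.log (N / m) + 1) ≤ m / 200) :
    ((2 * N + k - 1).choose k : ℝ) * (10 / 11) ^ m < 1 := by
  have hm' : (0 : ℝ) < m := by exact_mod_cast hm
  have hk' : (0 : ℝ) < k := by exact_mod_cast hk0
  have hmN' : (m : ℝ) ≤ N := by exact_mod_cast hmN
  have hN' : (0 : ℝ) < N := hm'.trans_le hmN'
  have hlog0 : 0 ≤ Real.log (N / m) := Real.log_nonneg ((one_le_div hm').mpr hmN')
  set L := Real.log (N / m) + 1 with hL
  have hL1 : 1 ≤ L := by linarith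
  have hkm : (k : ℝ) ≤ m / 200 := by nlinarith
  have hkN : k ≤ N := by
    have : (k : ℝ) ≤ N := by linarith
    exact_mod_cast this
  have hlog600 : Real.log 600 ≤ 7 := by
    rw [Real.log_le_iff_le_exp (by norm_num)]
    have h := Real.exp_one_gt_d9
    calc (600 : ℝ) ≤ 2.7 ^ 7 := by norm_num
      _ ≤ Real.exp 1 ^ 7 := by gcongr; linarith
      _ = Real.exp 7 := by rw [← Real.exp_nat_mul]; norm_num
  have hchoose : ((2 * N + k - 1).choose k : ℝ) ≤
      Real.exp (k * (Real.log (3 * N / k) + 1)) := by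
    calc ((2 * N + k - 1).choose k : ℝ) ≤ ((2 * N + k - 1 : ℕ) : ℝ) ^ k / k.factorial :=
          Nat.choose_le_pow_div _ _
      _ ≤ (3 * N : ℝ) ^ k / k.factorial := by
          gcongr
          exact_mod_cast (by omega : 2 * N + k - 1 ≤ 3 * N)
      _ = (3 * N / k : ℝ) ^ k * ((k : ℝ) ^ k / k.factorial) := by
          rw [div_pow]; field_simp
      _ ≤ (3 * N / k : ℝ) ^ k * Real.exp k := by
          gcongr
          exact Real.pow_div_factorial_le_exp _ hk'.le k
      _ = _ := by
          rw [mul_add, mul_one, Real.exp_add, Real.exp_nat_mul, Real.exp_log (by positivity)]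
  have hsplit : Real.log (3 * N / k) =
      Real.log 600 + Real.log (N / m) + Real.log L + Real.log (m / 200 / L / k) := by
    rw [← Real.log_mul (by norm_num) (by positivity), ← Real.log_mul (by positivity) (by positivity),
      ← Real.log_mul (by positivity) (by positivity)]
    congr 1
    field_simp
    norm_num
  have hlogL : Real.log L ≤ L - 1 := Real.log_le_sub_one_of_pos (by linarith)
  have hlogk : k * Real.log (m / 200 / L / k) ≤ m / 200 := by
    calc k * Real.log (m / 200 / L / k) ≤ k * (m / 200 / L / k - 1) := by
          gcongr; exact Real.log_le_sub_one_of_pos (by positivity)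
      _ = m / 200 / L - k := by field_simp
      _ ≤ m / 200 / L := by linarith
      _ ≤ m / 200 := div_le_self (by positivity) hL1
  have hten : ((10 : ℝ) / 11) ^ m ≤ Real.exp (-(m / 11)) := by
    have h := Real.one_sub_le_exp_neg (1 / 11)
    calc ((10 : ℝ) / 11) ^ m ≤ Real.exp (-(1 / 11)) ^ m := by gcongr; linarith
      _ = _ := by rw [← Real.exp_nat_mul]; congr 1; ring
  calc ((2 * N + k - 1).choose k : ℝ) * (10 / 11) ^ m
      ≤ Real.exp (k * (Real.log (3 * N / k) + 1)) * Real.exp (-(m / 11)) := by gcongr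
    _ = Real.exp (k * (Real.log (3 * N / k) + 1) + -(m / 11)) := (Real.exp_add _ _).symm
    _ < 1 := by
      rw [Real.exp_lt_one_iff, hsplit]
      have e : Real.log (N / m) = L - 1 := by rw [hL]; ring
      rw [e]
      have : k * Real.log L ≤ k * (L - 1) := by gcongr
      have : k * Real.log 600 ≤ k * 7 := by gcongr
      nlinarith

lemma sum_rpow_le_rpow_sum_of_sum_le_one {ι : Type*} [Fintype ι] {f : ι → ℝ} (hf : ∀ i, 0 ≤ f i)
    {a r b : ℝ} (ha : 0 < a) (har : a ≤ r) (hrb : r ≤ b) (h1 : ∑ i, f i ^ a ≤ 1) :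
    ∑ i, f i ^ r ≤ (∑ i, f i ^ b) ^ ((r - a) / (b - a)) := by
  rcases har.eq_or_lt with rfl | har
  · simpa using h1
  have hP : 1 ≤ (b - a) / (r - a) := by
    rw [one_le_div (by linarith)]; linarith
  have h := Real.inner_le_weight_mul_Lp_of_nonneg Finset.univ hP (fun i => f i ^ a)
    (fun i => f i ^ (r - a)) (fun i => Real.rpow_nonneg (hf i) _)
    (fun i => Real.rpow_nonneg (hf i) _)
  have e1 : ∀ i, f i ^ a * f i ^ (r - a) = f i ^ r := fun i => by
    rw [← Real.rpow_add_of_nonneg (hf i) ha.le (by linarith)]; congr 1; ring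
  have e2 : ∀ i, f i ^ a * (f i ^ (r - a)) ^ ((b - a) / (r - a)) = f i ^ b := fun i => by
    rw [← Real.rpow_mul (hf i), mul_div_cancel₀ _ (by linarith),
      ← Real.rpow_add_of_nonneg (hf i) ha.le (by linarith)]
    congr 1; ring
  simp only [e1, e2, inv_div] at h
  refine h.trans ?_
  have hb0 : 0 ≤ ∑ i, f i ^ b := Finset.sum_nonneg fun i _ => Real.rpow_nonneg (hf i) _
  refine mul_le_of_le_one_left (Real.rpow_nonneg hb0 _) ?_
  refine Real.rpow_le_one (Finset.sum_nonneg fun i _ => Real.rpow_nonneg (hf i) _) h1 ?_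
  rw [sub_nonneg, div_le_one (by linarith)]
  linarith

lemma sum_rpow_le_of_sq_sum_le {ι : Type*} [Fintype ι] {f : ι → ℝ} (hf : ∀ i, 0 ≤ f i)
    {p q A : ℝ} (hp : 0 < p) (hp1 : p ≤ 1) (hpq : p < q) (hq : q ≤ 2) (hA : 0 ≤ A)
    (h1 : ∑ i, f i ^ p ≤ 1) (h2 : ∑ i, f i ^ (2 : ℝ) ≤ A * (∑ i, f i) ^ 2) :
    ∑ i, f i ^ q ≤ A ^ ((q - p) / p) := by
  set S := ∑ i, f i ^ (2 : ℝ) with hS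
  have hS0 : 0 ≤ S := Finset.sum_nonneg fun i _ => Real.rpow_nonneg (hf i) _
  have hf0 : 0 ≤ ∑ i, f i := Finset.sum_nonneg fun i _ => hf i
  have hone := sum_rpow_le_rpow_sum_of_sum_le_one hf hp hp1 one_le_two h1
  have hq' := sum_rpow_le_rpow_sum_of_sum_le_one hf hp hpq.le hq h1
  simp only [Real.rpow_one] at hone
  rw [← hS] at hone hq'
  have h2p : 0 < 2 - p := by linarith
  have hSA : S ≤ A ^ ((2 - p) / p) := by
    rcases hS0.eq_or_lt with h0 | hpos
    · rw [← h0]; positivity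
    have h3 : S ≤ A * S ^ (2 * ((1 - p) / (2 - p))) := by
      refine h2.trans ?_
      gcongr
      rw [mul_comm, Real.rpow_mul hS0]
      exact_mod_cast pow_le_pow_left₀ hf0 hone 2
    have h4 : S ^ (p / (2 - p)) ≤ A := by
      have e : p / (2 - p) = 1 - 2 * ((1 - p) / (2 - p)) := by field_simp; ring
      rw [e, Real.rpow_sub hpos, Real.rpow_one, div_le_iff₀ (by positivity)]
      exact h3
    calc S = (S ^ (p / (2 - p))) ^ ((2 - p) / p) := by
          rw [← Real.rpow_mul hS0, div_mul_div_cancel₀ h2p.ne', div_self hp.ne', Real.rpow_one]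
      _ ≤ _ := by gcongr
  calc ∑ i, f i ^ q ≤ S ^ ((q - p) / (2 - p)) := hq'
    _ ≤ (A ^ ((2 - p) / p)) ^ ((q - p) / (2 - p)) := by
        gcongr
    _ = _ := by
        rw [← Real.rpow_mul hA]
        congr 1
        field_simp

lemma pNorm_ofReal {p : ℝ} (hp : 0 < p) {N : ℕ} (x : Fin N → ℝ) :
    pNorm (ENNReal.ofReal p) x = (∑ i, |x i| ^ p) ^ (1 / p) := by
  simp [pNorm, ENNReal.toReal_ofReal hp.le]

lemma pNorm_ofReal_nonneg {p : ℝ} (hp : 0 < p) {N : ℕ} (x : Fin N → ℝ) :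
    0 ≤ pNorm (ENNReal.ofReal p) x := by
  rw [pNorm_ofReal hp]; positivity

lemma pNorm_ofReal_le_iff {p : ℝ} (hp : 0 < p) {N : ℕ} (x : Fin N → ℝ) {D : ℝ} (hD : 0 ≤ D) :
    pNorm (ENNReal.ofReal p) x ≤ D ↔ ∑ i, |x i| ^ p ≤ D ^ p := by
  rw [pNorm_ofReal hp, one_div, Real.rpow_inv_le_iff_of_pos (by positivity) hD hp]

lemma pNorm_ofReal_smul {p : ℝ} (hp : 0 < p) {N : ℕ} (c : ℝ) (x : Fin N → ℝ) :
    pNorm (ENNReal.ofReal p) (c • x) = |c| * pNorm (ENNReal.ofReal p) x := by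
  rw [pNorm_ofReal hp, pNorm_ofReal hp]
  simp only [Pi.smul_apply, smul_eq_mul, abs_mul]
  simp only [Real.mul_rpow (abs_nonneg _) (abs_nonneg _), ← Finset.mul_sum]
  rw [Real.mul_rpow (by positivity) (by positivity), ← Real.rpow_mul (abs_nonneg _),
    mul_one_div_cancel hp.ne', Real.rpow_one]

lemma pNorm_le_one_of_le {p q : ℝ} (hp : 0 < p) (hpq : p ≤ q) {N : ℕ} {x : Fin N → ℝ}
    (hx : pNorm (ENNReal.ofReal p) x ≤ 1) : pNorm (ENNReal.ofReal q) x ≤ 1 := by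
  rw [pNorm_ofReal_le_iff hp x zero_le_one, Real.one_rpow] at hx
  rw [pNorm_ofReal_le_iff (hp.trans_le hpq) x zero_le_one, Real.one_rpow]
  refine le_trans (Finset.sum_le_sum fun i _ => ?_) hx
  have hxi : |x i| ^ p ≤ 1 := (Finset.single_le_sum (f := fun i => |x i| ^ p)
    (fun j _ => by positivity) (Finset.mem_univ i)).trans hx
  rcases (abs_nonneg (x i)).eq_or_lt with h | h
  · rw [← h, Real.zero_rpow hp.ne', Real.zero_rpow (hp.trans_le hpq).ne']
  · refine Real.rpow_le_rpow_of_exponent_ge h ?_ hpq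
    by_contra! hcon
    exact absurd hxi (not_le.mpr (Real.one_lt_rpow hcon hp))

lemma gelfandNumber_le {p q : ℝ} (hp : 0 < p) (hq : 0 < q) {N n : ℕ} {M : Submodule ℝ (Fin N → ℝ)}
    (hM : N - Module.finrank ℝ M < n) {D : ℝ}
    (h : ∀ x ∈ M, pNorm (ENNReal.ofReal p) x ≤ 1 → pNorm (ENNReal.ofReal q) x ≤ D) :
    gelfandNumber (ENNReal.ofReal p) (ENNReal.ofReal q) N n ≤ D := by
  unfold gelfandNumber
  refine le_trans (csInf_le ⟨0, ?_⟩ ⟨M, hM, rfl⟩)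
    (csSup_le ⟨_, 0, M.zero_mem, ?_, rfl⟩ ?_)
  · rintro r ⟨M', -, rfl⟩
    refine Real.sSup_nonneg ?_
    rintro s ⟨x, -, -, rfl⟩
    exact pNorm_ofReal_nonneg hq x
  · simp [pNorm_ofReal hp, Real.zero_rpow hp.ne', hp.ne']
  · rintro s ⟨x, hx, hx1, rfl⟩
    exact h x hx hx1

lemma le_gelfandNumber {p q : ℝ} (hp : 0 < p) (hpq : p ≤ q) {N n : ℕ} (hn : 0 < n) {D : ℝ}
    (h : ∀ M : Submodule ℝ (Fin N → ℝ), N - Module.finrank ℝ M < n → ∀ d : ℝ,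
      0 ≤ d → (∀ x ∈ M, pNorm (ENNReal.ofReal q) x ≤ d * pNorm (ENNReal.ofReal p) x) → D ≤ d) :
    D ≤ gelfandNumber (ENNReal.ofReal p) (ENNReal.ofReal q) N n := by
  refine le_csInf ⟨_, ⊤, by simpa using hn, rfl⟩ ?_
  rintro r ⟨M, hM, rfl⟩
  refine h M hM _ (Real.sSup_nonneg ?_) fun x hx => ?_
  · rintro s ⟨x, -, -, rfl⟩
    exact pNorm_ofReal_nonneg (hp.trans_le hpq) x
  rcases (pNorm_ofReal_nonneg hp x).eq_or_lt with h0 | hpos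
  · rw [← h0, mul_zero]
    rw [pNorm_ofReal hp, eq_comm, Real.rpow_eq_zero (by positivity) (by positivity),
      Finset.sum_eq_zero_iff_of_nonneg fun i _ => by positivity] at h0
    have hx0 : x = 0 := by
      ext i
      have := h0 i (Finset.mem_univ i)
      rw [Real.rpow_eq_zero (abs_nonneg _) hp.ne'] at this
      simpa using this
    have hq := hp.trans_le hpq
    simp [hx0, pNorm_ofReal hq, Real.zero_rpow hq.ne', hq.ne']
  · rw [← div_le_iff₀ hpos]
    refine le_csSup ⟨1, ?_⟩ ⟨(pNorm (ENNReal.ofReal p) x)⁻¹ • x, M.smul_mem _ hx, ?_, ?_⟩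
    · rintro s ⟨y, -, hy, rfl⟩
      exact pNorm_le_one_of_le hp hpq hy
    · rw [pNorm_ofReal_smul hp, abs_inv, abs_of_pos hpos, inv_mul_cancel₀ hpos.ne']
    · rw [pNorm_ofReal_smul (hp.trans_le hpq), abs_inv, abs_of_pos hpos, div_eq_inv_mul]

lemma gelfandNumber_le_min_rpow {p q : ℝ} (hp : 0 < p) (hp1 : p ≤ 1) (hpq : p < q) (hq : q ≤ 2)
    {N m : ℕ} (hm : 0 < m) (hmN : m ≤ N) :
    gelfandNumber (ENNReal.ofReal p) (ENNReal.ofReal q) N (m + 1) ≤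
      6400 ^ (1 / p - 1 / q) *
        (min 1 ((Real.log (N / m) + 1) / m)) ^ (1 / p - 1 / q) := by
  have hm' : (0 : ℝ) < m := by exact_mod_cast hm
  have hmN' : (m : ℝ) ≤ N := by exact_mod_cast hmN
  have hL1 : 1 ≤ Real.log (N / m) + 1 := by
    linarith [Real.log_nonneg ((one_le_div hm').mpr hmN')]
  set L := Real.log (N / m) + 1 with hL
  have hL0 : 0 < L := by linarith
  have hα : 0 < 1 / p - 1 / q := sub_pos.mpr (one_div_lt_one_div_of_lt hp hpq)
  rw [← Real.mul_rpow (by norm_num) (by positivity)]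
  rcases lt_or_ge ((m : ℝ) / 200) L with hlarge | hsmall
  · have h1 : gelfandNumber (ENNReal.ofReal p) (ENNReal.ofReal q) N (m + 1) ≤ 1 :=
      gelfandNumber_le hp (hp.trans hpq) (M := ⊤) (by simp)
        fun x _ hx => pNorm_le_one_of_le hp hpq.le hx
    refine h1.trans (Real.one_le_rpow ?_ hα.le)
    have : 1 / 200 ≤ min 1 (L / m) := by
      refine le_min (by norm_num) ?_
      rw [le_div_iff₀ hm']; linarith
    linarith
  · have hmin : min 1 (L / m) = L / m := by
      refine min_eq_right ?_
      rw [div_le_one hm']; linarith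
    rw [hmin]
    have hone : 1 ≤ m / 200 / L := by rwa [one_le_div hL0]
    set k := ⌊(m : ℝ) / 200 / L⌋₊ with hk
    have hk0 : 0 < k := Nat.floor_pos.mpr hone
    have hk' : (0 : ℝ) < k := by exact_mod_cast hk0
    have hkle : (k : ℝ) ≤ m / 200 / L := Nat.floor_le (by positivity)
    have hkge : m / 200 / L < k + 1 := Nat.lt_floor_add_one _
    have hk1 : (1 : ℝ) ≤ k := by exact_mod_cast hk0
    obtain ⟨M, hM, hMx⟩ := exists_submodule_sq_sum_le hm hk0
      (choose_mul_pow_lt_one hm hmN hk0 (by rwa [← le_div_iff₀ hL0]))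
    refine gelfandNumber_le hp (hp.trans hpq) (M := M) (by omega) fun x hx hx1 => ?_
    rw [pNorm_ofReal_le_iff hp x zero_le_one, Real.one_rpow] at hx1
    rw [pNorm_ofReal_le_iff (hp.trans hpq) x (by positivity), ← Real.rpow_mul (by positivity)]
    have hexp : (1 / p - 1 / q) * q = (q - p) / p := by
      have := (hp.trans hpq).ne'
      field_simp
    rw [hexp]
    refine sum_rpow_le_of_sq_sum_le (fun i => abs_nonneg (x i)) hp hp1 hpq hq (by positivity) hx1 ?_
    have hA : (16 : ℝ) / k ≤ 6400 * (L / m) := by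
      rw [div_le_iff₀ hk']
      have : m / 200 / L ≤ 2 * k := by linarith
      rw [div_div, div_le_iff₀ (by positivity)] at this
      rw [← mul_div_assoc, div_mul_eq_mul_div, le_div_iff₀ hm']
      nlinarith
    have hsum0 : 0 ≤ ∑ i, |x i| := by positivity
    simp only [Real.rpow_two, sq_abs]
    rcases hsum0.eq_or_lt with h0 | hpos
    · have hx0 : ∀ i, x i = 0 := fun i => by
        simpa using (Finset.sum_eq_zero_iff_of_nonneg fun i _ => abs_nonneg (x i)).mp h0.symm i
          (Finset.mem_univ i)
      simp [hx0]
    · have h := hMx ((∑ i, |x i|)⁻¹ • x) (M.smul_mem _ hx) (by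
        simp [abs_mul, abs_inv, ← Finset.mul_sum, abs_of_pos hpos, inv_mul_cancel₀ hpos.ne'])
      simp only [Pi.smul_apply, smul_eq_mul, mul_pow, ← Finset.mul_sum, inv_pow] at h
      rw [inv_mul_le_iff₀ (by positivity)] at h
      rw [mul_comm] at h
      exact h.trans (by gcongr)

lemma exists_separated_finsets {N t r : ℕ} (ht : 0 < t) (hN : r * (2 * t) ≤ N) :
    ∃ F : Finset (Finset (Fin N)), (∀ S ∈ F, #S = 2 * t) ∧
      (∀ S ∈ F, ∀ S' ∈ F, S ≠ S' → #(S ∩ S') < t) ∧ r ^ t ≤ #F * 4 ^ t := by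
  classical
  rcases Nat.eq_zero_or_pos r with rfl | hr
  · exact ⟨∅, by simp, by simp, by simp [ht.ne']⟩
  let agree : (Fin (2 * t) → Fin r) → (Fin (2 * t) → Fin r) → ℕ := fun f g => #{i | f i = g i}
  obtain ⟨F, hF, hmax⟩ := Finset.exists_max_image
    (Finset.univ.filter fun F : Finset (Fin (2 * t) → Fin r) =>
      ∀ f ∈ F, ∀ g ∈ F, f ≠ g → agree f g < t) Finset.card ⟨∅, by simp⟩
  simp only [mem_filter, mem_univ, true_and] at hF hmax
  have hcomm : ∀ f g, agree f g = agree g f := fun f g => by simp [agree, eq_comm]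
  have hcover : ∀ g, ∃ f ∈ F, t ≤ agree f g := by
    intro g
    by_cases hg : g ∈ F
    · exact ⟨g, hg, by simp [agree]; omega⟩
    · by_contra! hcon
      have := hmax (insert g F) (by
        intro f hf f' hf' hne
        rcases mem_insert.mp hf with rfl | h1 <;> rcases mem_insert.mp hf' with rfl | h2
        · exact absurd rfl hne
        · rw [hcomm]; exact hcon _ h2
        · exact hcon _ h1
        · exact hF f h1 f' h2 hne)
      rw [card_insert_of_notMem hg] at this
      omega
  have hball : ∀ f, #{g | t ≤ agree f g} ≤ 4 ^ t * r ^ t := by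
    intro f
    have hsub : ({g | t ≤ agree f g} : Finset (Fin (2 * t) → Fin r)) ⊆
        (powersetCard t (Finset.univ : Finset (Fin (2 * t)))).biUnion fun T =>
          Fintype.piFinset fun i => if i ∈ T then {f i} else Finset.univ := by
      intro g hg
      simp only [mem_filter, mem_univ, true_and] at hg
      obtain ⟨T, hT, hTc⟩ := exists_subset_card_eq hg
      simp only [mem_biUnion, mem_powersetCard, Fintype.mem_piFinset]
      refine ⟨T, ⟨subset_univ _, hTc⟩, fun i => ?_⟩
      split_ifs with hi
      · have := hT hi
        simp only [mem_filter, mem_univ, true_and] at this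
        simp [this]
      · exact mem_univ _
    calc #{g | t ≤ agree f g} ≤ _ := card_le_card hsub
      _ ≤ #(powersetCard t (Finset.univ : Finset (Fin (2 * t)))) * r ^ t := by
        refine card_biUnion_le_card_mul _ _ _ fun T hT => ?_
        rw [Fintype.card_piFinset]
        simp only [apply_ite Finset.card, card_singleton, card_univ, Fintype.card_fin]
        rw [Finset.prod_ite]
        simp only [prod_const, one_pow, one_mul]
        refine (congrArg (r ^ ·) ?_).le
        have h1 : (Finset.univ.filter fun i => i ∉ T) = Tᶜ := by ext; simp
        rw [h1, card_compl, (mem_powersetCard.mp hT).2]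
        simp; omega
      _ ≤ 4 ^ t * r ^ t := by
        gcongr
        rw [card_powersetCard, card_univ, Fintype.card_fin]
        calc (2 * t).choose t ≤ 2 ^ (2 * t) := Nat.choose_le_two_pow _ _
          _ = 4 ^ t := by rw [pow_mul]; norm_num
  have hcount : r ^ (2 * t) ≤ #F * (4 ^ t * r ^ t) := by
    calc r ^ (2 * t) = #(Finset.univ : Finset (Fin (2 * t) → Fin r)) := by simp
      _ ≤ #(F.biUnion fun f => {g | t ≤ agree f g}) := by
        refine card_le_card fun g _ => ?_
        simpa using hcover g
      _ ≤ _ := card_biUnion_le_card_mul _ _ _ fun f _ => hball f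
  obtain ⟨e⟩ : Nonempty (Fin (2 * t) × Fin r ↪ Fin N) :=
    Function.Embedding.nonempty_of_card_le (by simpa [mul_comm] using hN)
  let graph : (Fin (2 * t) → Fin r) → Finset (Fin N) := fun f =>
    Finset.univ.image fun i => e (i, f i)
  have hgraph : ∀ f, #(graph f) = 2 * t := by
    intro f
    rw [card_image_of_injective, card_univ, Fintype.card_fin]
    intro i j hij
    exact congrArg Prod.fst (e.injective hij)
  have hinter : ∀ f g, #(graph f ∩ graph g) ≤ agree f g := by
    intro f g
    refine (card_le_card (t := ({i | f i = g i} : Finset _).image fun i => e (i, f i)) ?_).trans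
      card_image_le
    intro a ha
    simp only [graph, mem_inter, mem_image, mem_univ, true_and] at ha
    obtain ⟨⟨i, rfl⟩, j, hj⟩ := ha
    have h := e.injective hj
    simp only [Prod.mk.injEq] at h
    obtain ⟨rfl, h⟩ := h
    simp only [mem_image, mem_filter, mem_univ, true_and]
    exact ⟨j, h.symm, rfl⟩
  have hinj : Set.InjOn graph F := by
    intro f hf g hg hfg
    by_contra hne
    have h1 := hinter f g
    rw [← hfg, inter_self, hgraph] at h1
    have := hF f hf g hg hne
    omega
  refine ⟨F.image graph, ?_, ?_, ?_⟩
  · simp only [mem_image, forall_exists_index, and_imp]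
    rintro S f - rfl
    exact hgraph f
  · simp only [mem_image, forall_exists_index, and_imp]
    rintro S f hf rfl S' g hg rfl hne
    exact (hinter f g).trans_lt (hF f hf g hg fun h => hne (by rw [h]))
  · rw [card_image_of_injOn hinj]
    refine Nat.le_of_mul_le_mul_right ?_ (pow_pos hr t)
    calc r ^ t * r ^ t = r ^ (2 * t) := by ring
      _ ≤ _ := hcount
      _ = _ := by ring

lemma sum_rpow_abs_add_le {ι : Type*} (s : Finset ι) {p : ℝ} (hp : 0 < p) (hp1 : p ≤ 1)
    (u v : ι → ℝ) : ∑ i ∈ s, |u i + v i| ^ p ≤ ∑ i ∈ s, |u i| ^ p + ∑ i ∈ s, |v i| ^ p := by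
  rw [← Finset.sum_add_distrib]
  refine Finset.sum_le_sum fun i _ => ?_
  calc |u i + v i| ^ p ≤ (|u i| + |v i|) ^ p := by gcongr; exact abs_add_le _ _
    _ ≤ _ := Real.rpow_add_le_add_rpow (abs_nonneg _) (abs_nonneg _) hp.le hp1

lemma sum_rpow_abs_smul {ι : Type*} [Fintype ι] {p : ℝ} (c : ℝ) (hc : 0 ≤ c) (u : ι → ℝ) :
    ∑ i, |(c • u) i| ^ p = c ^ p * ∑ i, |u i| ^ p := by
  simp only [Pi.smul_apply, smul_eq_mul, abs_mul, abs_of_nonneg hc,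
    Real.mul_rpow hc (abs_nonneg _), Finset.mul_sum]

open MeasureTheory Pointwise in
lemma card_le_of_separated_mod_submodule {N : ℕ} {p : ℝ} (hp : 0 < p) (hp1 : p ≤ 1)
    (M : Submodule ℝ (Fin N → ℝ)) {ι : Type*} (F : Finset ι) (y : ι → Fin N → ℝ) {a ρ : ℝ}
    (ha : 0 ≤ a) (hρ : 0 < ρ) (hy : ∀ i ∈ F, ∑ j, |y i j| ^ p ≤ a)
    (hsep : ∀ i ∈ F, ∀ i' ∈ F, i ≠ i' → ∀ u v : Fin N → ℝ, ∑ j, |u j| ^ p < ρ →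
      ∑ j, |v j| ^ p < ρ → y i - y i' + (u - v) ∉ M) :
    (#F : ℝ) ≤ (((a + ρ) / ρ) ^ (1 / p)) ^ (N - Module.finrank ℝ M) := by
  set c := N - Module.finrank ℝ M with hc
  have hfin : Module.finrank ℝ ((Fin N → ℝ) ⧸ M) = Module.finrank ℝ (Fin c → ℝ) := by
    rw [Submodule.finrank_quotient]; simp [hc]
  let T : (Fin N → ℝ) →ₗ[ℝ] (Fin c → ℝ) :=
    (LinearEquiv.ofFinrankEq _ _ hfin).toLinearMap ∘ₗ M.mkQ
  have hTsurj : Function.Surjective T :=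
    (LinearEquiv.ofFinrankEq _ _ hfin).surjective.comp M.mkQ_surjective
  have hTker : ∀ x, T x = 0 → x ∈ M := by
    intro x hx
    have : M.mkQ x = 0 := (LinearEquiv.ofFinrankEq _ _ hfin).map_eq_zero_iff.mp hx
    simpa using this
  let B : Set (Fin N → ℝ) := {u | ∑ j, |u j| ^ p < 1}
  have hBopen : IsOpen B := by
    refine isOpen_lt (continuous_finsetSum _ fun j _ => ?_) continuous_const
    exact ((continuous_apply j).abs).rpow_const fun _ => Or.inr hp.le
  set U := T '' B with hU
  have hUopen : IsOpen U := T.isOpenMap_of_finiteDimensional hTsurj _ hBopen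
  have hUne : U.Nonempty := ⟨T 0, 0, by simp [B, Real.zero_rpow hp.ne'], rfl⟩
  have hUfin : volume U ≠ ⊤ := by
    have hsub : U ⊆ T '' Metric.closedBall 0 1 := by
      refine Set.image_mono fun u hu => ?_
      rw [mem_closedBall_zero_iff, pi_norm_le_iff_of_nonneg zero_le_one]
      intro j
      have hj : |u j| ^ p < 1 := (Finset.single_le_sum (f := fun j => |u j| ^ p)
        (fun j _ => by positivity) (Finset.mem_univ j)).trans_lt hu
      rw [Real.norm_eq_abs]
      by_contra! hcon
      exact absurd hj (not_lt.mpr (Real.one_lt_rpow hcon hp).le)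
    have hcomp : IsCompact (T '' Metric.closedBall 0 1) :=
      (isCompact_closedBall _ _).image T.continuous_of_finiteDimensional
    exact ((measure_mono hsub).trans_lt hcomp.measure_lt_top).ne
  have hUpos : volume U ≠ 0 := (hUopen.measure_pos volume hUne).ne'
  set s := ρ ^ (1 / p) with hs
  set s' := (a + ρ) ^ (1 / p) with hs'
  have hs0 : 0 < s := by positivity
  have hs0' : 0 < s' := by positivity
  have hsp : s ^ p = ρ := by
    rw [hs, ← Real.rpow_mul hρ.le, one_div_mul_cancel hp.ne', Real.rpow_one]
  have hsp' : s' ^ p = a + ρ := by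
    rw [hs', ← Real.rpow_mul (by positivity), one_div_mul_cancel hp.ne', Real.rpow_one]
  have hscale : ∀ u ∈ B, ∑ j, |(s • u) j| ^ p < ρ := by
    intro u hu
    rw [sum_rpow_abs_smul s hs0.le, hsp]
    exact mul_lt_of_lt_one_right hρ hu
  have hdisj : (F : Set ι).PairwiseDisjoint fun i => T (y i) +ᵥ (s • U) := by
    intro i hi i' hi' hne
    refine Set.disjoint_left.mpr ?_
    rintro _ ⟨_, ⟨_, ⟨u, hu, rfl⟩, rfl⟩, rfl⟩ ⟨_, ⟨_, ⟨v, hv, rfl⟩, rfl⟩, heq⟩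
    refine hsep i hi i' hi' hne (s • u) (s • v) (hscale u hu) (hscale v hv) (hTker _ ?_)
    simp only [vadd_eq_add] at heq
    simp only [map_add, map_sub, map_smul]
    rw [sub_add_sub_comm, ← heq, sub_self]
  have hsub : (⋃ i ∈ F, T (y i) +ᵥ (s • U)) ⊆ s' • U := by
    simp only [Set.iUnion_subset_iff]
    rintro i hi _ ⟨_, ⟨_, ⟨u, hu, rfl⟩, rfl⟩, rfl⟩
    refine ⟨_, ⟨s'⁻¹ • (y i + s • u), ?_, rfl⟩, ?_⟩
    · have h1 := sum_rpow_abs_add_le Finset.univ hp hp1 (y i) (s • u)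
      have h2 : ∑ j, |(y i + s • u) j| ^ p < a + ρ :=
        h1.trans_lt (add_lt_add_of_le_of_lt (hy i hi) (hscale u hu))
      change ∑ j, |(s'⁻¹ • (y i + s • u)) j| ^ p < 1
      rw [sum_rpow_abs_smul _ (by positivity), Real.inv_rpow hs0'.le, hsp',
        inv_mul_lt_iff₀ (by positivity)]
      simpa using h2
    · simp only [map_smul, map_add, smul_smul, mul_inv_cancel₀ hs0'.ne', one_smul, vadd_eq_add]
  have hmeas := measure_mono (μ := volume) hsub
  rw [measure_biUnion_finset hdisj fun i _ =>
    ((hUopen.smul₀ hs0.ne').vadd _).measurableSet] at hmeas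
  simp only [measure_vadd, Measure.addHaar_smul, Module.finrank_fin_fun, Finset.sum_const,
    nsmul_eq_mul, ← mul_assoc] at hmeas
  rw [ENNReal.mul_le_mul_iff_left hUpos hUfin, abs_of_pos (by positivity),
    abs_of_pos (by positivity), ← ENNReal.ofReal_natCast, ← ENNReal.ofReal_mul (by positivity),
    ENNReal.ofReal_le_ofReal_iff (by positivity)] at hmeas
  rw [Real.div_rpow (by positivity) hρ.le, div_pow, le_div_iff₀ (by positivity)]
  exact hmeas

lemma sum_rpow_le_of_pNorm_le {N : ℕ} {p q d : ℝ} (hp : 0 < p) (hpq : p < q) (hd : 0 ≤ d)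
    {x : Fin N → ℝ} (hx : pNorm (ENNReal.ofReal q) x ≤ d * pNorm (ENNReal.ofReal p) x)
    {W : Finset (Fin N)} {w : ℝ} (hW : #W ≤ w) :
    ∑ i ∈ W, |x i| ^ p ≤ (w ^ (1 / p - 1 / q) * d) ^ p * ∑ i, |x i| ^ p := by
  have hq := hp.trans hpq
  have hw0 : 0 ≤ w := (Nat.cast_nonneg _).trans hW
  have h := Real.rpow_sum_le_const_mul_sum_rpow W (fun i => |x i| ^ p) (p := q / p)
    (by rw [one_le_div hp]; exact hpq.le)
  have e1 : ∀ i, |(|x i| ^ p)| = |x i| ^ p := fun i => abs_of_nonneg (by positivity)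
  have e2 : ∀ i, (|x i| ^ p) ^ (q / p) = |x i| ^ q := fun i => by
    rw [← Real.rpow_mul (abs_nonneg _), mul_div_cancel₀ _ hp.ne']
  simp only [e1, e2] at h
  have hP0 : 0 ≤ pNorm (ENNReal.ofReal p) x := pNorm_ofReal_nonneg hp x
  have hxq : ∑ i, |x i| ^ q ≤ (d * pNorm (ENNReal.ofReal p) x) ^ q :=
    (pNorm_ofReal_le_iff hq x (by positivity)).mp hx
  have hxp : pNorm (ENNReal.ofReal p) x ^ p = ∑ i, |x i| ^ p := by
    rw [pNorm_ofReal hp, ← Real.rpow_mul (by positivity), one_div_mul_cancel hp.ne', Real.rpow_one]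
  have hWsum : ∑ i ∈ W, |x i| ^ q ≤ ∑ i, |x i| ^ q :=
    Finset.sum_le_sum_of_subset_of_nonneg (subset_univ _) fun i _ _ => by positivity
  have h2 : (∑ i ∈ W, |x i| ^ p) ^ (q / p) ≤
      w ^ (q / p - 1) * (d * pNorm (ENNReal.ofReal p) x) ^ q := by
    refine h.trans (mul_le_mul (Real.rpow_le_rpow (by positivity) hW ?_) (hWsum.trans hxq)
      (by positivity) (by positivity))
    rw [sub_nonneg, one_le_div hp]; exact hpq.le
  calc ∑ i ∈ W, |x i| ^ p = ((∑ i ∈ W, |x i| ^ p) ^ (q / p)) ^ (p / q) := by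
        rw [← Real.rpow_mul (by positivity), div_mul_div_cancel₀ hp.ne', div_self hq.ne',
          Real.rpow_one]
    _ ≤ (w ^ (q / p - 1) * (d * pNorm (ENNReal.ofReal p) x) ^ q) ^ (p / q) := by gcongr
    _ = _ := by
        rw [← hxp, ← Real.mul_rpow (by positivity) hP0,
          Real.mul_rpow (by positivity) (by positivity), ← Real.rpow_mul hw0,
          ← Real.rpow_mul (by positivity), mul_div_cancel₀ _ hq.ne', mul_assoc,
          Real.mul_rpow (x := w ^ (1 / p - 1 / q)) (by positivity) (by positivity),
          ← Real.rpow_mul hw0]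
        congr 2
        field_simp

lemma pow_le_of_pNorm_le {N m t r : ℕ} {p q d : ℝ} (hp : 0 < p) (hp1 : p ≤ 1) (hpq : p < q)
    (hd : 0 ≤ d) {M : Submodule ℝ (Fin N → ℝ)} (hM : N - Module.finrank ℝ M ≤ m)
    (hMd : ∀ x ∈ M, pNorm (ENNReal.ofReal q) x ≤ d * pNorm (ENNReal.ofReal p) x)
    (ht : 0 < t) (hN : r * (2 * t) ≤ N)
    (htd : (4 * t : ℝ) ^ (1 / p - 1 / q) * d ≤ (1 / 4) ^ (1 / p)) :
    (r : ℝ) ^ t ≤ ((5 : ℝ) ^ (1 / p)) ^ m * 4 ^ t := by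
  obtain ⟨F, hFc, hFs, hF⟩ := exists_separated_finsets ht hN
  have ht' : (0 : ℝ) < t := by exact_mod_cast ht
  let y : Finset (Fin N) → Fin N → ℝ := fun S i => if i ∈ S then 1 else 0
  have habs : ∀ S i, |y S i| ^ p = y S i := fun S i => by
    by_cases h : i ∈ S <;> simp [y, h, hp.ne']
  have hsum : ∀ S, ∑ i, y S i = #S := fun S => by simp [y]
  have hquarter : ((4 * t : ℝ) ^ (1 / p - 1 / q) * d) ^ p ≤ 1 / 4 := by
    calc _ ≤ ((1 / 4 : ℝ) ^ (1 / p)) ^ p := by gcongr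
      _ = 1 / 4 := by
        rw [← Real.rpow_mul (by norm_num), one_div_mul_cancel hp.ne', Real.rpow_one]
  have hcard : (#F : ℝ) ≤ (((2 * t + t / 2 : ℝ) / (t / 2)) ^ (1 / p)) ^
      (N - Module.finrank ℝ M) := by
    refine card_le_of_separated_mod_submodule hp hp1 M F y (by positivity) (by positivity) ?_ ?_
    · intro S hS
      simp only [habs, hsum, hFc S hS]
      push_cast; rfl
    · intro S hS S' hS' hne u v hu hv hmem
      set x := y S - y S' + (u - v) with hx
      have hinter := hFs S hS S' hS' hne
      have hdiff : ∀ i, |y S i - y S' i| ^ p = y S i + y S' i - 2 * y (S ∩ S') i := fun i => by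
        by_cases h : i ∈ S <;> by_cases h' : i ∈ S' <;>
          simp [y, h, h', hp.ne'] <;> norm_num
      have hY : (2 * t : ℝ) < ∑ i, |y S i - y S' i| ^ p := by
        simp only [hdiff, Finset.sum_sub_distrib, Finset.sum_add_distrib, ← Finset.mul_sum, hsum,
          hFc S hS, hFc S' hS']
        have : (#(S ∩ S') : ℝ) < t := by exact_mod_cast hinter
        push_cast
        linarith
      have hYW : ∑ i ∈ S ∪ S', |y S i - y S' i| ^ p = ∑ i, |y S i - y S' i| ^ p := by
        refine Finset.sum_subset (subset_univ _) fun i _ hi => ?_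
        simp only [mem_union, not_or] at hi
        simp [y, hi.1, hi.2, hp.ne']
      have hWn : ∑ i, |u i - v i| ^ p < t := by
        have h := sum_rpow_abs_add_le Finset.univ hp hp1 u (-v)
        simp only [Pi.neg_apply, abs_neg, ← sub_eq_add_neg] at h
        linarith
      have hWsub : ∑ i ∈ S ∪ S', |u i - v i| ^ p ≤ ∑ i, |u i - v i| ^ p :=
        Finset.sum_le_sum_of_subset_of_nonneg (subset_univ _) fun i _ _ => by positivity
      have h1 : ∑ i, |x i| ^ p ≤ ∑ i, |y S i - y S' i| ^ p + ∑ i, |u i - v i| ^ p :=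
        sum_rpow_abs_add_le Finset.univ hp hp1 (y S - y S') (u - v)
      have h2 : ∑ i ∈ S ∪ S', |y S i - y S' i| ^ p ≤
          ∑ i ∈ S ∪ S', |x i| ^ p + ∑ i ∈ S ∪ S', |u i - v i| ^ p := by
        have h := sum_rpow_abs_add_le (S ∪ S') hp hp1 x (-(u - v))
        have e : ∀ i, x i + -(u i - v i) = y S i - y S' i := fun i => by
          simp only [hx, Pi.add_apply, Pi.sub_apply]; ring
        simpa only [Pi.neg_apply, Pi.sub_apply, e, abs_neg] using h
      have h3 : ∑ i ∈ S ∪ S', |x i| ^ p ≤ 1 / 4 * ∑ i, |x i| ^ p := by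
        refine (sum_rpow_le_of_pNorm_le hp hpq hd (hMd x hmem) (w := 4 * t) ?_).trans ?_
        · have := card_union_le S S'
          rw [hFc S hS, hFc S' hS'] at this
          exact_mod_cast this.trans (by omega)
        · gcongr
      linarith
  have h5 : (2 * t + t / 2 : ℝ) / (t / 2) = 5 := by field_simp; norm_num
  rw [h5] at hcard
  have hone : (1 : ℝ) ≤ 5 ^ (1 / p) := Real.one_le_rpow (by norm_num) (by positivity)
  calc (r : ℝ) ^ t ≤ #F * 4 ^ t := by exact_mod_cast hF
    _ ≤ ((5 : ℝ) ^ (1 / p)) ^ (N - Module.finrank ℝ M) * 4 ^ t := by gcongr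
    _ ≤ _ := by gcongr

lemma exists_const_le_gelfandNumber {p q : ℝ} (hp : 0 < p) (hp1 : p ≤ 1) (hpq : p < q) :
    ∃ C : ℝ, 0 < C ∧ ∀ N m : ℕ, 0 < m → m < N →
      C * (min 1 ((Real.log (N / m) + 1) / m)) ^ (1 / p - 1 / q) ≤
        gelfandNumber (ENNReal.ofReal p) (ENNReal.ofReal q) N (m + 1) := by
  have hα : 0 < 1 / p - 1 / q := sub_pos.mpr (one_div_lt_one_div_of_lt hp hpq)
  set α := 1 / p - 1 / q with hαdef
  set b := 4 / p with hb
  have hb4 : 4 ≤ b := by rw [hb, le_div_iff₀ hp]; linarith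
  set ℓ := Real.log (32 * b) with hℓ
  have hℓ0 : 0 ≤ ℓ := Real.log_nonneg (by linarith)
  set B := Real.exp (2 + 2 * ℓ) with hB
  have hB32 : (32 * b) ≤ B := by
    rw [← Real.log_le_iff_le_exp (by positivity)]; linarith
  have hlogB : Real.log B = 2 + 2 * ℓ := Real.log_exp _
  have hB0 : 0 < B := Real.exp_pos _
  have hQ : 0 < B * (3 + 2 * ℓ) := by positivity
  refine ⟨min ((1 / 4) ^ (1 / p) / (8 * b) ^ α) (1 / (B * (3 + 2 * ℓ)) ^ α), by positivity, ?_⟩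
  intro N m hm hmN
  have hm' : (0 : ℝ) < m := by exact_mod_cast hm
  have hm1 : (1 : ℝ) ≤ m := by exact_mod_cast hm
  have hmN' : (m : ℝ) < N := by exact_mod_cast hmN
  have hN' : (0 : ℝ) < N := hm'.trans hmN'
  have hL1 : 1 ≤ Real.log (N / m) + 1 := by
    linarith [Real.log_nonneg ((one_le_div hm').mpr hmN'.le)]
  set L := Real.log (N / m) + 1 with hL
  set K := min 1 (L / m) with hK
  have hK0 : 0 < K := by positivity
  have hK1 : K ≤ 1 := min_le_left _ _
  have hKL : K ≤ L / m := min_le_right _ _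
  have hKm : 1 / m ≤ K := le_min (by rw [div_le_one hm']; exact hm1) (by gcongr)
  refine le_gelfandNumber hp hpq.le m.succ_pos fun M hM d hd hMd => ?_
  by_contra! hcon
  have hcon1 : d < (1 / 4) ^ (1 / p) / (8 * b) ^ α * K ^ α :=
    hcon.trans_le (by gcongr; exact min_le_left _ _)
  have hcon2 : d < 1 / (B * (3 + 2 * ℓ)) ^ α * K ^ α :=
    hcon.trans_le (by gcongr; exact min_le_right _ _)
  rcases le_or_gt (N : ℝ) (B * m) with hsmall | hlarge
  · obtain ⟨x, hx, hx0⟩ : ∃ x ∈ M, x ≠ 0 := by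
      refine (Submodule.ne_bot_iff M).mp fun hbot => ?_
      rw [hbot, finrank_bot] at hM
      omega
    have h := sum_rpow_le_of_pNorm_le hp hpq hd (hMd x hx) (W := Finset.univ) (w := N) (by simp)
    have hpos : 0 < ∑ i, |x i| ^ p := by
      obtain ⟨i, hi⟩ := Function.ne_iff.mp hx0
      have : 0 < |x i| := abs_pos.mpr hi
      exact Finset.sum_pos' (fun i _ => by positivity) ⟨i, Finset.mem_univ i, by positivity⟩
    have h1 : 1 ≤ ((N : ℝ) ^ α * d) ^ p := by
      by_contra! hlt
      nlinarith
    have h2 : 1 ≤ (N : ℝ) ^ α * d := by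
      by_contra! hlt
      exact absurd h1 (not_le.mpr (Real.rpow_lt_one (by positivity) hlt hp))
    have hLle : L ≤ 3 + 2 * ℓ := by
      have : Real.log (N / m) ≤ Real.log B :=
        Real.log_le_log (by positivity) ((div_le_iff₀ hm').mpr hsmall)
      linarith
    have hNK : N * K ≤ B * (3 + 2 * ℓ) := by
      calc N * K ≤ (B * m) * (L / m) := by gcongr
        _ = B * L := by field_simp
        _ ≤ _ := by gcongr
    have h3 : (N : ℝ) ^ α * d < 1 := by
      calc (N : ℝ) ^ α * d < N ^ α * (1 / (B * (3 + 2 * ℓ)) ^ α * K ^ α) := by gcongr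
        _ = (N * K) ^ α / (B * (3 + 2 * ℓ)) ^ α := by
          rw [Real.mul_rpow hN'.le hK0.le]; ring
        _ ≤ 1 := by
          rw [div_le_one (by positivity)]
          gcongr
    linarith
  · have hbK : b ≤ b / K := le_div_self (by positivity) hK0 hK1
    set t := ⌈b / K⌉₊ with ht
    have htge : b / K ≤ t := Nat.le_ceil _
    have htlt : (t : ℝ) < b / K + 1 := Nat.ceil_lt_add_one (by positivity)
    have ht' : (0 : ℝ) < t := by linarith
    have ht0 : 0 < t := by exact_mod_cast ht'
    have ht2 : (t : ℝ) ≤ 2 * b / K := by rw [mul_div_assoc]; linarith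
    have htm : (t : ℝ) ≤ 2 * b * m := by
      refine ht2.trans ?_
      rw [div_le_iff₀ hK0]
      rw [div_le_iff₀ hm'] at hKm
      nlinarith
    have htL : b * m ≤ t * L := by
      rw [le_div_iff₀ hm'] at hKL
      rw [div_le_iff₀ hK0] at htge
      calc b * m ≤ t * K * m := by gcongr
        _ = t * (K * m) := by ring
        _ ≤ t * L := by gcongr
    set r := N / (2 * t) with hr
    have hrge : (N : ℝ) / (8 * b * m) ≤ r := by
      have h1 : N < (r + 1) * (2 * t) := by
        rw [hr, mul_comm]; exact Nat.lt_mul_div_succ N (by omega)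
      have h1' : (N : ℝ) < (r + 1) * (2 * t) := by exact_mod_cast h1
      have h2 : (r + 1 : ℝ) * (2 * t) ≤ (r + 1) * (4 * b * m) :=
        mul_le_mul_of_nonneg_left (by linarith) (by positivity)
      rw [div_le_iff₀ (by positivity)]
      have h3 : 32 * b * m ≤ B * m := by gcongr
      have h5 : 0 < b * m := by positivity
      have h4 : (N : ℝ) < (r + 1) * (4 * b * m) := h1'.trans_le h2
      linarith
    have hr0 : (0 : ℝ) < r := lt_of_lt_of_le (by positivity) hrge
    have hlogr : L / 2 ≤ Real.log (r / 4) := by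
      have h1 : Real.log (N / m) - ℓ ≤ Real.log (r / 4) := by
        rw [hℓ, ← Real.log_div (by positivity) (by positivity)]
        refine Real.log_le_log (by positivity) ?_
        calc (N : ℝ) / m / (32 * b) = N / (8 * b * m) / 4 := by field_simp; norm_num
          _ ≤ r / 4 := by gcongr
      have h2 : Real.log B ≤ Real.log (N / m) :=
        Real.log_le_log hB0 ((le_div_iff₀ hm').mpr hlarge.le)
      linarith
    have htd : (4 * t : ℝ) ^ α * d ≤ (1 / 4) ^ (1 / p) := by
      have h1 : (4 * t : ℝ) ≤ 8 * b / K := by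
        rw [mul_div_assoc] at ht2 ⊢; linarith
      calc (4 * t : ℝ) ^ α * d
          ≤ (8 * b / K) ^ α * ((1 / 4) ^ (1 / p) / (8 * b) ^ α * K ^ α) := by gcongr
        _ = (1 / 4) ^ (1 / p) := by
          rw [Real.div_rpow (by positivity) hK0.le]
          field_simp
    have hpack := pow_le_of_pNorm_le (m := m) hp hp1 hpq hd (by omega) hMd ht0
      (Nat.div_mul_le_self N (2 * t)) htd
    have hlog5 : Real.log 5 < 2 := by
      rw [Real.log_lt_iff_lt_exp (by norm_num)]
      have h := Real.exp_one_gt_d9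
      calc (5 : ℝ) < 2.7 ^ 2 := by norm_num
        _ ≤ Real.exp 1 ^ 2 := by gcongr; linarith
        _ = Real.exp 2 := by rw [← Real.exp_nat_mul]; norm_num
    have hlogs : t * Real.log (r / 4) ≤ m * (1 / p * Real.log 5) := by
      rw [← div_le_iff₀ (by positivity), ← div_pow] at hpack
      have h := Real.log_le_log (by positivity) hpack
      rwa [Real.log_pow, Real.log_pow, Real.log_rpow (by norm_num)] at h
    have h1 : t * (L / 2) ≤ t * Real.log (r / 4) := by gcongr
    have h2 : m * (1 / p * Real.log 5) < m * (1 / p * 2) := by gcongr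
    have h3 : b * m = m * (1 / p * 4) := by rw [hb]; ring
    linarith

/-- For `0 < p₁ ≤ 1` and `p₁ < p₂ ≤ 2` there are constants `C₁, C₂ > 0`, depending
only on `p₁` and `p₂`, such that for all `2 ≤ n ≤ N`,
`C₁·min{1,(ln(N/(n-1))+1)/(n-1)}^{1/p₁-1/p₂} ≤ c_n(id : ℓ_{p₁}^N → ℓ_{p₂}^N)
≤ C₂·min{1,(ln(N/(n-1))+1)/(n-1)}^{1/p₁-1/p₂}`. -/
theorem gelfand_two_sided_small_p2 (p₁ p₂ : ℝ) (h1 : 0 < p₁) (h2 : p₁ ≤ 1)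
    (h3 : p₁ < p₂) (h4 : p₂ ≤ 2) :
    ∃ C₁ C₂ : ℝ, 0 < C₁ ∧ 0 < C₂ ∧ ∀ N n : ℕ, 2 ≤ n → n ≤ N →
      C₁ * (min 1 ((Real.log ((N : ℝ) / ((n : ℝ) - 1)) + 1) / ((n : ℝ) - 1)))
            ^ (1/p₁ - 1/p₂) ≤
          gelfandNumber (ENNReal.ofReal p₁) (ENNReal.ofReal p₂) N n ∧
      gelfandNumber (ENNReal.ofReal p₁) (ENNReal.ofReal p₂) N n ≤
        C₂ * (min 1 ((Real.log ((N : ℝ) / ((n : ℝ) - 1)) + 1) / ((n : ℝ) - 1)))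
            ^ (1/p₁ - 1/p₂) := by
  obtain ⟨C, hC, hlower⟩ := exists_const_le_gelfandNumber h1 h2 h3
  refine ⟨C, 6400 ^ (1 / p₁ - 1 / p₂), hC, by positivity, fun N n hn hnN => ?_⟩
  obtain ⟨m, rfl⟩ : ∃ m, n = m + 1 := ⟨n - 1, by omega⟩
  have hcast : ((m + 1 : ℕ) : ℝ) - 1 = m := by push_cast; ring
  rw [hcast]
  exact ⟨hlower N m (by omega) (by omega),
    gelfandNumber_le_min_rpow h1 h2 h3 h4 (by omega) (by omega)⟩
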